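/- Let φ : ℝ³ → ℝ be a smooth graphical translator, i.e. Θ[φ] = 0. Define |A_φ|² := |Hess φ|²/(1+|Dφ|²) − 2|Hess φ · Dφ|²/(1+|Dφ|²)² + (Hess φ(Dφ,Dφ))²/(1+|Dφ|²)³ (the squared norm of the second fundamental form of graph(φ)) and A₄₄ := Hess φ(Dφ,Dφ)/(1+|Dφ|²)^{5/2}. Then at every point where Dφ ≠ 0 one has L_φ(log H_φ) ≥ −|A_φ|² · H_φ + A₄₄² / ((1−H_φ²) · H_φ). -/

import Mathlib

open Real

noncomputable section

/-- Euclidean 3-space. -/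
abbrev E3 : Type := EuclideanSpace ℝ (Fin 3)

/-- The point (a,b,c) ∈ ℝ³. -/
def mk3 (a b c : ℝ) : E3 := (WithLp.equiv 2 (Fin 3 → ℝ)).symm ![a, b, c]

/-- Partial derivative in the i-th coordinate direction. -/
def pd (i : Fin 3) (f : E3 → ℝ) (x : E3) : ℝ := fderiv ℝ f x (EuclideanSpace.single i 1)

/-- Squared norm of the gradient, |Dφ|². -/
def gradSq (φ : E3 → ℝ) (x : E3) : ℝ := ∑ i, (pd i φ x) ^ 2

/-- Divergence of a vector field on ℝ³, given componentwise. -/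
def divg (F : Fin 3 → E3 → ℝ) (x : E3) : ℝ := ∑ i, pd i (F i) x

/-- Mean curvature of graph(φ): H_φ = 1/√(1+|Dφ|²). -/
def Hmc (φ : E3 → ℝ) (x : E3) : ℝ := 1 / sqrt (1 + gradSq φ x)

/-- The translator operator Θ[φ] = div(Dφ/√(1+|Dφ|²)) − 1/√(1+|Dφ|²). -/
def Θop (φ : E3 → ℝ) (x : E3) : ℝ :=
  divg (fun i y => pd i φ y / sqrt (1 + gradSq φ y)) x - 1 / sqrt (1 + gradSq φ x)

/-- The linearized translator operator L_φ u = div(a_φ Du) + b_φ · Du. -/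
def Lop (φ u : E3 → ℝ) (x : E3) : ℝ :=
  divg (fun i y => ∑ j, ((if i = j then (1:ℝ) else 0) / sqrt (1 + gradSq φ y)
        - pd i φ y * pd j φ y / (1 + gradSq φ y) ^ ((3:ℝ)/2)) * pd j u y) x
  + ∑ i, pd i φ x * pd i u x / (1 + gradSq φ x) ^ ((3:ℝ)/2)

/-- Entries of the Hessian of φ. -/
def hess (φ : E3 → ℝ) (x : E3) (i j : Fin 3) : ℝ := pd i (pd j φ) x

lemma ContDiff.pd {f : E3 → ℝ} (hf : ContDiff ℝ (⊤ : ℕ∞) f) (i : Fin 3) :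
    ContDiff ℝ (⊤ : ℕ∞) (pd i f) :=
  (hf.fderiv_right (m := (⊤ : ℕ∞)) (by simp)).clm_apply contDiff_const

lemma pd_add {f g : E3 → ℝ} {x : E3} (hf : DifferentiableAt ℝ f x) (hg : DifferentiableAt ℝ g x)
    (i : Fin 3) : pd i (fun y => f y + g y) x = pd i f x + pd i g x := by
  simp [pd, fderiv_fun_add hf hg]

lemma pd_sub {f g : E3 → ℝ} {x : E3} (hf : DifferentiableAt ℝ f x) (hg : DifferentiableAt ℝ g x)
    (i : Fin 3) : pd i (fun y => f y - g y) x = pd i f x - pd i g x := by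
  simp [pd, fderiv_fun_sub hf hg]

lemma pd_const (c : ℝ) (x : E3) (i : Fin 3) : pd i (fun _ => c) x = 0 := by
  simp [pd]

lemma pd_mul {f g : E3 → ℝ} {x : E3} (hf : DifferentiableAt ℝ f x) (hg : DifferentiableAt ℝ g x)
    (i : Fin 3) : pd i (fun y => f y * g y) x = pd i f x * g x + f x * pd i g x := by
  simp [pd, fderiv_fun_mul hf hg]
  ring

lemma pd_sum {ι : Type*} (s : Finset ι) {f : ι → E3 → ℝ} {x : E3}
    (hf : ∀ k ∈ s, DifferentiableAt ℝ (f k) x) (i : Fin 3) :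
    pd i (fun y => ∑ k ∈ s, f k y) x = ∑ k ∈ s, pd i (f k) x := by
  simp [pd, fderiv_fun_sum hf]

lemma pd_comp {G : ℝ → ℝ} {G' : ℝ} {f : E3 → ℝ} {x : E3} (hG : HasDerivAt G G' (f x))
    (hf : DifferentiableAt ℝ f x) (i : Fin 3) : pd i (fun y => G (f y)) x = G' * pd i f x := by
  have h := (hG.comp_hasFDerivAt x hf.hasFDerivAt).fderiv
  unfold pd
  rw [show (fun y => G (f y)) = G ∘ f from rfl, h]
  simp

lemma pd_pow {f : E3 → ℝ} {x : E3} (hf : DifferentiableAt ℝ f x) (n : ℕ) (i : Fin 3) :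
    pd i (fun y => f y ^ n) x = n * f x ^ (n - 1) * pd i f x :=
  pd_comp (hasDerivAt_pow n (f x)) hf i

lemma pd_comm {f : E3 → ℝ} (hf : ContDiff ℝ (⊤ : ℕ∞) f) (i j : Fin 3) (x : E3) :
    pd i (pd j f) x = pd j (pd i f) x := by
  have hd : DifferentiableAt ℝ (fderiv ℝ f) x :=
    (hf.fderiv_right (m := (⊤ : ℕ∞)) (by simp)).differentiable (by simp) x
  have key (k l : Fin 3) : pd k (pd l f) x =
      fderiv ℝ (fderiv ℝ f) x (EuclideanSpace.single k 1) (EuclideanSpace.single l 1) := by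
    change fderiv ℝ (fun y => fderiv ℝ f y (EuclideanSpace.single l 1)) x _ = _
    rw [fderiv_clm_apply hd (differentiableAt_const _)]
    simp
  rw [key, key]
  refine hf.contDiffAt.isSymmSndFDerivAt ?_ _ _
  rw [minSmoothness_of_isRCLikeNormedField]
  exact WithTop.coe_le_coe.2 (le_top : (2 : ℕ∞) ≤ ⊤)

lemma gradSq_nonneg (φ : E3 → ℝ) (x : E3) : 0 ≤ gradSq φ x :=
  Finset.sum_nonneg fun _ _ => sq_nonneg _

lemma Hmc_pos (φ : E3 → ℝ) (x : E3) : 0 < Hmc φ x := by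
  have := gradSq_nonneg φ x
  unfold Hmc
  positivity

lemma sqrt_one_add_gradSq (φ : E3 → ℝ) (x : E3) : sqrt (1 + gradSq φ x) = (Hmc φ x)⁻¹ := by
  simp [Hmc]

lemma one_add_gradSq (φ : E3 → ℝ) (x : E3) : 1 + gradSq φ x = (Hmc φ x ^ 2)⁻¹ := by
  have := gradSq_nonneg φ x
  rw [← inv_pow, ← sqrt_one_add_gradSq, sq_sqrt (by positivity)]

lemma one_add_gradSq_rpow (φ : E3 → ℝ) (x : E3) (n : ℕ) :
    (1 + gradSq φ x) ^ ((n : ℝ) / 2) = (Hmc φ x ^ n)⁻¹ := by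
  have := gradSq_nonneg φ x
  rw [← inv_pow, ← sqrt_one_add_gradSq, sqrt_eq_rpow, ← rpow_mul_natCast (by positivity)]
  congr 1
  ring

/-- The vector `Hess φ · Dφ`. -/
def hessGrad (φ : E3 → ℝ) (i : Fin 3) (x : E3) : ℝ := ∑ j, hess φ x i j * pd j φ x

/-- The scalar `Hess φ (Dφ, Dφ)`. -/
def hessGradGrad (φ : E3 → ℝ) (x : E3) : ℝ := ∑ i, pd i φ x * hessGrad φ i x

/-- The Laplacian of `φ`. -/
def lap (φ : E3 → ℝ) (x : E3) : ℝ := ∑ i, hess φ x i i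

lemma contDiff_gradSq {φ : E3 → ℝ} (hφ : ContDiff ℝ (⊤ : ℕ∞) φ) : ContDiff ℝ (⊤ : ℕ∞) (gradSq φ) :=
  ContDiff.sum fun i _ => (hφ.pd i).pow 2

lemma contDiff_Hmc {φ : E3 → ℝ} (hφ : ContDiff ℝ (⊤ : ℕ∞) φ) : ContDiff ℝ (⊤ : ℕ∞) (Hmc φ) := by
  have hpos (x : E3) : 0 < 1 + gradSq φ x := by
    have := gradSq_nonneg φ x
    positivity
  exact contDiff_const.div ((contDiff_const.add (contDiff_gradSq hφ)).sqrt fun x => (hpos x).ne')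
    fun x => (sqrt_pos.2 (hpos x)).ne'

lemma contDiff_hess {φ : E3 → ℝ} (hφ : ContDiff ℝ (⊤ : ℕ∞) φ)
    (i j : Fin 3) : ContDiff ℝ (⊤ : ℕ∞) (fun x => hess φ x i j) :=
  (hφ.pd j).pd i

lemma contDiff_hessGrad {φ : E3 → ℝ} (hφ : ContDiff ℝ (⊤ : ℕ∞) φ)
    (i : Fin 3) : ContDiff ℝ (⊤ : ℕ∞) (hessGrad φ i) :=
  ContDiff.sum fun j _ => (contDiff_hess hφ i j).mul (hφ.pd j)

lemma contDiff_hessGradGrad {φ : E3 → ℝ} (hφ : ContDiff ℝ (⊤ : ℕ∞) φ) : ContDiff ℝ (⊤ : ℕ∞) (hessGradGrad φ) :=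
  ContDiff.sum fun i _ => (hφ.pd i).mul (contDiff_hessGrad hφ i)

lemma pd_gradSq {φ : E3 → ℝ} (hφ : ContDiff ℝ (⊤ : ℕ∞) φ)
    (i : Fin 3) (x : E3) : pd i (gradSq φ) x = 2 * hessGrad φ i x := by
  have hd (j : Fin 3) := (hφ.pd j).differentiable (by simp) x
  change pd i (fun y => ∑ j, pd j φ y ^ 2) x = _
  rw [pd_sum _ fun j _ => (hd j).fun_pow 2, hessGrad, Finset.mul_sum]
  refine Finset.sum_congr rfl fun j _ => ?_
  rw [pd_pow (hd j)]
  simp [hess]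
  ring

lemma pd_Hmc {φ : E3 → ℝ} (hφ : ContDiff ℝ (⊤ : ℕ∞) φ)
    (i : Fin 3) (x : E3) : pd i (Hmc φ) x = -hessGrad φ i x * Hmc φ x ^ 3 := by
  have hH := Hmc_pos φ x
  have hd := (contDiff_Hmc hφ).differentiable (by simp) x
  have hg := (contDiff_gradSq hφ).differentiable (by simp) x
  have hone (y : E3) : Hmc φ y ^ 2 * (1 + gradSq φ y) = 1 := by
    rw [one_add_gradSq]
    exact mul_inv_cancel₀ (pow_ne_zero 2 (Hmc_pos φ y).ne')
  have h : pd i (fun y => Hmc φ y ^ 2 * (1 + gradSq φ y)) x = 0 := by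
    simp only [hone, pd_const]
  rw [pd_mul (hd.fun_pow 2) ((differentiableAt_const _).fun_add hg), pd_pow hd,
    pd_add (differentiableAt_const _) hg, pd_const, pd_gradSq hφ, one_add_gradSq] at h
  field_simp at h
  norm_num at h
  refine mul_left_cancel₀ hH.ne' ?_
  linear_combination h / 2

lemma pd_log_Hmc {φ : E3 → ℝ} (hφ : ContDiff ℝ (⊤ : ℕ∞) φ)
    (i : Fin 3) (x : E3) :
    pd i (fun y => log (Hmc φ y)) x = -hessGrad φ i x * Hmc φ x ^ 2 := by
  have hH := Hmc_pos φ x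
  rw [pd_comp (hasDerivAt_log hH.ne') ((contDiff_Hmc hφ).differentiable (by simp) x), pd_Hmc hφ]
  field_simp

lemma Θop_eq {φ : E3 → ℝ} (hφ : ContDiff ℝ (⊤ : ℕ∞) φ)
    (x : E3) :
    Θop φ x = lap φ x * Hmc φ x - hessGradGrad φ x * Hmc φ x ^ 3 - Hmc φ x := by
  have hd := (contDiff_Hmc hφ).differentiable (by simp) x
  simp only [Θop, divg, sqrt_one_add_gradSq, div_inv_eq_mul, one_mul]
  congr 1
  simp only [lap, hessGradGrad, Finset.sum_mul, ← Finset.sum_sub_distrib]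
  refine Finset.sum_congr rfl fun i _ => ?_
  rw [pd_mul ((hφ.pd i).differentiable (by simp) x) hd, pd_Hmc hφ, hess]
  ring

lemma sum_pd_hessGrad {φ : E3 → ℝ} (hφ : ContDiff ℝ (⊤ : ℕ∞) φ)
    (x : E3) :
    ∑ i, pd i (hessGrad φ i) x = ∑ k, pd k φ x * pd k (lap φ) x + ∑ i, ∑ j, hess φ x i j ^ 2 := by
  have hh (i j : Fin 3) := (contDiff_hess hφ i j).differentiable (by simp) x
  have hd (j : Fin 3) := (hφ.pd j).differentiable (by simp) x
  have hlap (k : Fin 3) : pd k (lap φ) x = ∑ i, pd i (fun y => hess φ y i k) x := by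
    change pd k (fun y => ∑ i, hess φ y i i) x = _
    rw [pd_sum _ fun i _ => hh i i]
    refine Finset.sum_congr rfl fun i _ => ?_
    change pd k (pd i (pd i φ)) x = pd i (pd i (pd k φ)) x
    rw [pd_comm (hφ.pd i), show pd k (pd i φ) = pd i (pd k φ) from funext (pd_comm hφ k i)]
  have hV (i : Fin 3) : pd i (hessGrad φ i) x =
      ∑ j, (pd i (fun y => hess φ y i j) x * pd j φ x + hess φ x i j ^ 2) := by
    change pd i (fun y => ∑ j, hess φ y i j * pd j φ y) x = _
    rw [pd_sum _ fun j _ => (hh i j).fun_mul (hd j)]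
    refine Finset.sum_congr rfl fun j _ => ?_
    rw [pd_mul (hh i j) (hd j)]
    simp only [hess]
    ring
  simp only [hV, hlap, Finset.sum_add_distrib, Finset.mul_sum]
  rw [Finset.sum_comm]
  simp only [mul_comm]

lemma Lop_log_Hmc_eq_sum {φ : E3 → ℝ} (hφ : ContDiff ℝ (⊤ : ℕ∞) φ)
    (x : E3) :
    Lop φ (fun y => log (Hmc φ y)) x =
      -(∑ i, pd i (hessGrad φ i) x) * Hmc φ x ^ 3
      + 3 * (∑ i, hessGrad φ i x ^ 2) * Hmc φ x ^ 5
      + lap φ x * hessGradGrad φ x * Hmc φ x ^ 5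
      + (∑ i, pd i φ x * pd i (hessGradGrad φ) x) * Hmc φ x ^ 5
      - 5 * hessGradGrad φ x ^ 2 * Hmc φ x ^ 7 - hessGradGrad φ x * Hmc φ x ^ 5 := by
  have hH := (contDiff_Hmc hφ).differentiable (by simp) x
  have hV (i : Fin 3) := (contDiff_hessGrad hφ i).differentiable (by simp) x
  have hq := (contDiff_hessGradGrad hφ).differentiable (by simp) x
  have hd (j : Fin 3) := (hφ.pd j).differentiable (by simp) x
  have h3 (y : E3) : (1 + gradSq φ y) ^ ((3 : ℝ) / 2) = (Hmc φ y ^ 3)⁻¹ := by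
    simpa using one_add_gradSq_rpow φ y 3
  have hF (i : Fin 3) (y : E3) :
      ∑ j, ((if i = j then (1:ℝ) else 0) * Hmc φ y - pd i φ y * pd j φ y * Hmc φ y ^ 3) *
        (-hessGrad φ j y * Hmc φ y ^ 2) =
      pd i φ y * hessGradGrad φ y * Hmc φ y ^ 5 - hessGrad φ i y * Hmc φ y ^ 3 := by
    simp only [sub_mul, Finset.sum_sub_distrib, ite_mul, one_mul, zero_mul, Finset.sum_ite_eq,
      Finset.mem_univ, if_true, hessGradGrad, Finset.mul_sum, Finset.sum_mul]
    rw [sub_eq_sub_iff_add_eq_add, ← sub_eq_zero]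
    simp only [Fin.sum_univ_three]
    ring
  simp only [Lop, divg, sqrt_one_add_gradSq, h3, div_inv_eq_mul, pd_log_Hmc hφ, hF]
  have hdiv (i : Fin 3) :
      pd i (fun y => pd i φ y * hessGradGrad φ y * Hmc φ y ^ 5 - hessGrad φ i y * Hmc φ y ^ 3) x =
      hess φ x i i * (hessGradGrad φ x * Hmc φ x ^ 5)
      + pd i φ x * pd i (hessGradGrad φ) x * Hmc φ x ^ 5
      - 5 * (pd i φ x * hessGrad φ i x) * (hessGradGrad φ x * Hmc φ x ^ 7)
      - pd i (hessGrad φ i) x * Hmc φ x ^ 3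
      + 3 * hessGrad φ i x ^ 2 * Hmc φ x ^ 5 := by
    rw [pd_sub (((hd i).fun_mul hq).fun_mul (hH.fun_pow 5)) ((hV i).fun_mul (hH.fun_pow 3)),
      pd_mul ((hd i).fun_mul hq) (hH.fun_pow 5), pd_mul (hd i) hq, pd_mul (hV i) (hH.fun_pow 3),
      pd_pow hH, pd_pow hH, pd_Hmc hφ]
    simp only [hess]
    push_cast
    ring
  simp only [hdiv]
  have hq' : hessGradGrad φ x = ∑ i, pd i φ x * hessGrad φ i x := rfl
  have hl : lap φ x = ∑ i, hess φ x i i := rfl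
  simp only [Fin.sum_univ_three] at hq' hl ⊢
  linear_combination -(hessGradGrad φ x * Hmc φ x ^ 5) * hl
    + (5 * hessGradGrad φ x * Hmc φ x ^ 7 + Hmc φ x ^ 5) * hq'

lemma lap_eq_of_translator {φ : E3 → ℝ} (hφ : ContDiff ℝ (⊤ : ℕ∞) φ)
    (hsol : ∀ x, Θop φ x = 0) (x : E3) : lap φ x = hessGradGrad φ x * Hmc φ x ^ 2 + 1 := by
  have h := hsol x
  rw [Θop_eq hφ] at h
  refine mul_right_cancel₀ (Hmc_pos φ x).ne' ?_
  linear_combination h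

lemma sum_pd_mul_pd_lap {φ : E3 → ℝ} (hφ : ContDiff ℝ (⊤ : ℕ∞) φ)
    (hsol : ∀ x, Θop φ x = 0) (x : E3) :
    ∑ k, pd k φ x * pd k (lap φ) x =
      (∑ k, pd k φ x * pd k (hessGradGrad φ) x) * Hmc φ x ^ 2
        - 2 * hessGradGrad φ x ^ 2 * Hmc φ x ^ 4 := by
  have hH := (contDiff_Hmc hφ).differentiable (by simp) x
  have hq := (contDiff_hessGradGrad hφ).differentiable (by simp) x
  have hk (k : Fin 3) : pd k (lap φ) x = pd k (hessGradGrad φ) x * Hmc φ x ^ 2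
      - 2 * hessGradGrad φ x * Hmc φ x ^ 4 * hessGrad φ k x := by
    rw [funext (lap_eq_of_translator hφ hsol), pd_add (hq.fun_mul (hH.fun_pow 2))
      (differentiableAt_const _), pd_mul hq (hH.fun_pow 2), pd_pow hH, pd_Hmc hφ, pd_const]
    push_cast
    ring
  have hq' : hessGradGrad φ x = ∑ i, pd i φ x * hessGrad φ i x := rfl
  simp only [hk]
  simp only [Fin.sum_univ_three] at hq' ⊢
  linear_combination 2 * hessGradGrad φ x * Hmc φ x ^ 4 * hq'

lemma Lop_log_Hmc_of_translator {φ : E3 → ℝ} (hφ : ContDiff ℝ (⊤ : ℕ∞) φ)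
    (hsol : ∀ x, Θop φ x = 0) (x : E3) :
    Lop φ (fun y => log (Hmc φ y)) x =
      -(∑ i, ∑ j, hess φ x i j ^ 2) * Hmc φ x ^ 3
      + 3 * (∑ i, hessGrad φ i x ^ 2) * Hmc φ x ^ 5
      - 2 * hessGradGrad φ x ^ 2 * Hmc φ x ^ 7 := by
  rw [Lop_log_Hmc_eq_sum hφ, sum_pd_hessGrad hφ, sum_pd_mul_pd_lap hφ hsol,
    lap_eq_of_translator hφ hsol]
  ring

lemma hessGradGrad_sq_le (φ : E3 → ℝ) (x : E3) :
    hessGradGrad φ x ^ 2 ≤ gradSq φ x * ∑ i, hessGrad φ i x ^ 2 :=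
  Finset.sum_mul_sq_le_sq_mul_sq _ _ _

lemma hessGradGrad_eq (φ : E3 → ℝ) (x : E3) :
    ∑ i, ∑ j, hess φ x i j * pd i φ x * pd j φ x = hessGradGrad φ x := by
  simp only [hessGradGrad, hessGrad, Finset.mul_sum]
  exact Finset.sum_congr rfl fun i _ => Finset.sum_congr rfl fun j _ => by ring

/-- for a smooth graphical translator φ, at every point where Dφ ≠ 0,
L_φ(log H_φ) ≥ −|A_φ|²·H_φ + A₄₄²/((1−H_φ²)·H_φ), where
|A_φ|² = |Hess φ|²/(1+|Dφ|²) − 2|Hess φ·Dφ|²/(1+|Dφ|²)² + (Hess φ(Dφ,Dφ))²/(1+|Dφ|²)³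
and A₄₄ = Hess φ(Dφ,Dφ)/(1+|Dφ|²)^{5/2}. -/
theorem statement2 (φ : E3 → ℝ) (hφ : ContDiff ℝ (⊤ : ℕ∞) φ)
    (hsol : ∀ x, Θop φ x = 0) (x : E3) (hgrad : ∃ i, pd i φ x ≠ 0) :
    Lop φ (fun y => log (Hmc φ y)) x ≥
      - ((∑ i, ∑ j, (hess φ x i j) ^ 2) / (1 + gradSq φ x)
          - 2 * (∑ i, (∑ j, hess φ x i j * pd j φ x) ^ 2) / (1 + gradSq φ x) ^ 2
          + (∑ i, ∑ j, hess φ x i j * pd i φ x * pd j φ x) ^ 2 / (1 + gradSq φ x) ^ 3)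
        * Hmc φ x
      + ((∑ i, ∑ j, hess φ x i j * pd i φ x * pd j φ x) / (1 + gradSq φ x) ^ ((5:ℝ)/2)) ^ 2
        / ((1 - (Hmc φ x) ^ 2) * Hmc φ x) := by
  have h5 : (1 + gradSq φ x) ^ ((5 : ℝ) / 2) = (Hmc φ x ^ 5)⁻¹ := by
    simpa using one_add_gradSq_rpow φ x 5
  have hpos : 0 < gradSq φ x := by
    obtain ⟨i, hi⟩ := hgrad
    exact Finset.sum_pos' (fun _ _ => sq_nonneg _) ⟨i, Finset.mem_univ i, by positivity⟩
  have hH := Hmc_pos φ x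
  have hw := one_add_gradSq φ x
  have hcs := hessGradGrad_sq_le φ x
  have hsub : 1 - Hmc φ x ^ 2 = gradSq φ x * Hmc φ x ^ 2 := by
    field_simp at hw
    linear_combination -hw
  rw [Lop_log_Hmc_of_translator hφ hsol, hessGradGrad_eq, h5, hsub, hw]
  change _ ≥ -(_ - 2 * (∑ i, hessGrad φ i x ^ 2) / _ + _) * _ + _
  generalize (∑ i, ∑ j, hess φ x i j ^ 2) = S
  generalize (∑ i, hessGrad φ i x ^ 2) = V at *
  generalize hessGradGrad φ x = q at *
  generalize gradSq φ x = g at *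
  generalize Hmc φ x = H at *
  have hA : q ^ 2 / g ≤ V := by
    rw [div_le_iff₀ hpos]
    linarith
  have hlast : (q / (H ^ 5)⁻¹) ^ 2 / (g * H ^ 2 * H) = (q ^ 2 / g) * H ^ 7 := by
    field_simp
  have hcomb : q ^ 2 / g * H ^ 7 = q ^ 2 / g * H ^ 5 - q ^ 2 * H ^ 7 := by
    have hg : q ^ 2 = q ^ 2 / g * g := by field_simp
    linear_combination -(q ^ 2 / g * H ^ 5) * hsub + H ^ 7 * hg
  have hmul := mul_le_mul_of_nonneg_right hA (pow_nonneg hH.le 5)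
  rw [hlast, hcomb]
  simp only [div_inv_eq_mul, inv_pow]
  nlinarith [hmul]
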